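/- Let W ⊂ ℝ³ be a rotationally invariant domain around the vertical axis Z, and M a smooth embedded surface in W \ Z. Then M is a θ-graph if and only if (a) M meets each rotationally invariant circle at most once and transversally, and (b) every closed curve in M has winding number 0 about Z. -/

import Mathlib

open Real Set

noncomputable section

abbrev E3 := EuclideanSpace ℝ (Fin 3)

def pt (a b c : ℝ) : E3 := (WithLp.equiv 2 (Fin 3 → ℝ)).symm ![a, b, c]

/-- Rotation by angle `φ` about the vertical axis `Z`. -/
def rot (φ : ℝ) (x : E3) : E3 :=
  pt (Real.cos φ * x 0 - Real.sin φ * x 1) (Real.sin φ * x 0 + Real.cos φ * x 1) (x 2)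

/-- The vertical coordinate axis. -/
def Zaxis : Set E3 := {x | x 0 = 0 ∧ x 1 = 0}

/-- The rotationally invariant circle through `p` (the orbit of `p` under rotations
about `Z`). -/
def circleThrough (p : E3) : Set E3 := {q | ∃ φ, rot φ p = q}

/-- `M` is a smooth embedded surface in the open set `U`: locally a regular level set
of a smooth function. -/
def IsEmbeddedSurfaceIn (M U : Set E3) : Prop :=
  M ⊆ U ∧ ∀ p ∈ M, ∃ f : E3 → ℝ, ∃ V : Set E3, IsOpen V ∧ p ∈ V ∧ V ⊆ U ∧
    ContDiffOn ℝ (⊤ : ℕ∞) f V ∧ M ∩ V = {x ∈ V | f x = 0} ∧ ∀ x ∈ M ∩ V, fderiv ℝ f x ≠ 0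

/-- `M ⊆ W \ Z` is a θ-graph: it has the form
`{(r cos θ(r,z), r sin θ(r,z), z) : (r,z) ∈ V}` for a smooth real-valued function `θ`
on an open set `V ⊆ {(r,z) : r > 0, (r,0,z) ∈ W}`. -/
def IsThetaGraph (W M : Set E3) : Prop :=
  ∃ V : Set (ℝ × ℝ), IsOpen V ∧ V ⊆ {q : ℝ × ℝ | 0 < q.1 ∧ pt q.1 0 q.2 ∈ W} ∧
    ∃ θf : ℝ × ℝ → ℝ, ContDiffOn ℝ (⊤ : ℕ∞) θf V ∧
      M = (fun q : ℝ × ℝ =>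
        pt (q.1 * Real.cos (θf q)) (q.1 * Real.sin (θf q)) q.2) '' V

open Filter Topology

@[simp] lemma pt_zero (a b c : ℝ) : pt a b c 0 = a := by simp [pt]
@[simp] lemma pt_one (a b c : ℝ) : pt a b c 1 = b := by simp [pt]
@[simp] lemma pt_two (a b c : ℝ) : pt a b c 2 = c := by simp [pt]

lemma E3_ext {x y : E3} (h0 : x 0 = y 0) (h1 : x 1 = y 1) (h2 : x 2 = y 2) : x = y := by
  ext i; fin_cases i <;> assumption

/-- the point with cylindrical coordinates. -/
def GG (u : (ℝ × ℝ) × ℝ) : E3 := pt (u.1.1 * Real.cos u.2) (u.1.1 * Real.sin u.2) u.1.2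

@[simp] lemma GG_zero (u : (ℝ × ℝ) × ℝ) : GG u 0 = u.1.1 * Real.cos u.2 := by simp [GG]
@[simp] lemma GG_one (u : (ℝ × ℝ) × ℝ) : GG u 1 = u.1.1 * Real.sin u.2 := by simp [GG]
@[simp] lemma GG_two (u : (ℝ × ℝ) × ℝ) : GG u 2 = u.1.2 := by simp [GG]
@[simp] lemma rot_zero' (φ : ℝ) (x : E3) : rot φ x 0 = Real.cos φ * x 0 - Real.sin φ * x 1 := by
  simp [rot]
@[simp] lemma rot_one' (φ : ℝ) (x : E3) : rot φ x 1 = Real.sin φ * x 0 + Real.cos φ * x 1 := by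
  simp [rot]
@[simp] lemma rot_two' (φ : ℝ) (x : E3) : rot φ x 2 = x 2 := by
  simp [rot]

lemma contDiff_GG : ContDiff ℝ (⊤ : ℕ∞) GG := by
  rw [contDiff_euclidean]
  intro i
  fin_cases i
  · simp only [Fin.zero_eta, GG_zero]; fun_prop
  · simp only [Fin.mk_one, GG_one]; fun_prop
  · simp only [Fin.reduceFinMk, GG_two]; fun_prop

lemma rot_GG (φ : ℝ) (q : ℝ × ℝ) (t : ℝ) : rot φ (GG (q, t)) = GG (q, t + φ) := by
  apply E3_ext <;> simp [Real.cos_add, Real.sin_add] <;> ring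

/-- radius -/
def rad (x : E3) : ℝ := Real.sqrt ((x 0) ^ 2 + (x 1) ^ 2)

lemma rad_GG {q : ℝ × ℝ} (hq : 0 < q.1) (t : ℝ) : rad (GG (q, t)) = q.1 := by
  have : (q.1 * Real.cos t) ^ 2 + (q.1 * Real.sin t) ^ 2 = q.1 ^ 2 := by
    nlinarith [Real.sin_sq_add_cos_sq t]
  simp only [rad, GG_zero, GG_one, this]
  exact Real.sqrt_sq hq.le

lemma rad_pos {x : E3} (hx : x ∉ Zaxis) : 0 < rad x := by
  apply Real.sqrt_pos.2
  by_contra h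
  apply hx
  constructor <;> nlinarith [sq_nonneg (x 0), sq_nonneg (x 1)]

lemma exists_GG (x : E3) : ∃ t, x = GG ((rad x, x 2), t) := by
  refine ⟨Complex.arg ⟨x 0, x 1⟩, ?_⟩
  have hn : ‖(⟨x 0, x 1⟩ : ℂ)‖ = rad x := by
    rw [Complex.norm_def, Complex.normSq_mk, rad]; ring_nf
  apply E3_ext
  · simp only [GG_zero]; rw [← hn, Complex.norm_mul_cos_arg]
  · simp only [GG_one]; rw [← hn, Complex.norm_mul_sin_arg]
  · simp

lemma hasDerivAt_E3 {f : ℝ → E3} {f' : E3} {t : ℝ}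
    (h : ∀ i, HasDerivAt (fun s => f s i) (f' i) t) : HasDerivAt f f' t := by
  rw [hasDerivAt_iff_hasFDerivAt, ← hasFDerivWithinAt_univ, hasFDerivWithinAt_euclidean]
  intro i
  have := (h i).hasFDerivAt.hasFDerivWithinAt (s := univ)
  have e : (PiLp.proj 2 (fun _ : Fin 3 => ℝ) i ∘L ContinuousLinearMap.toSpanSingleton ℝ f' :
      ℝ →L[ℝ] ℝ) = ContinuousLinearMap.toSpanSingleton ℝ (f' i) := by
    ext
    simp
  exact e ▸ this

lemma hasDerivAt_rot (x : E3) : HasDerivAt (fun φ => rot φ x) (pt (-x 1) (x 0) 0) 0 := by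
  apply hasDerivAt_E3
  intro i
  fin_cases i
  · simp only [Fin.zero_eta, rot_zero', pt_zero]
    have := ((Real.hasDerivAt_cos 0).mul_const (x 0)).sub ((Real.hasDerivAt_sin 0).mul_const (x 1))
    simp only [Real.cos_zero, Real.sin_zero, neg_zero, zero_mul, one_mul, zero_sub, add_zero] at this
    exact this
  · simp only [Fin.mk_one, rot_one', pt_one]
    have := ((Real.hasDerivAt_sin 0).mul_const (x 0)).add ((Real.hasDerivAt_cos 0).mul_const (x 1))
    simp only [Real.cos_zero, Real.sin_zero, neg_zero, zero_mul, one_mul, zero_sub, add_zero] at this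
    exact this
  · simp only [Fin.reduceFinMk, rot_two', pt_two]
    exact hasDerivAt_const _ _

lemma hasDerivAt_GG (q : ℝ × ℝ) (t : ℝ) :
    HasDerivAt (fun s => GG (q, s)) (pt (-(q.1 * Real.sin t)) (q.1 * Real.cos t) 0) t := by
  apply hasDerivAt_E3
  intro i
  fin_cases i
  · simp only [Fin.zero_eta, GG_zero, pt_zero]
    simpa using (Real.hasDerivAt_cos t).const_mul q.1
  · simp only [Fin.mk_one, GG_one, pt_one]
    simpa using (Real.hasDerivAt_sin t).const_mul q.1
  · simp only [Fin.reduceFinMk, GG_two, pt_two]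
    exact hasDerivAt_const _ _

lemma GG_mem_circle {q : ℝ × ℝ} {t t' : ℝ} : GG (q, t') ∈ circleThrough (GG (q, t)) :=
  ⟨t' - t, by rw [rot_GG]; congr 2; ring⟩

lemma rad_rot (φ : ℝ) (x : E3) : rad (rot φ x) = rad x := by
  simp only [rad, rot_zero', rot_one']
  congr 1
  linear_combination ((x 0) ^ 2 + (x 1) ^ 2) * (Real.sin_sq_add_cos_sq φ)

lemma angle_const {u v : ℝ → ℝ} (hu : Continuous u) (hv : Continuous v) {S : Set ℝ}
    (hS : IsPreconnected S)
    (hc : ∀ s ∈ S, Real.cos (u s) = Real.cos (v s)) (hs : ∀ s ∈ S, Real.sin (u s) = Real.sin (v s))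
    {a b : ℝ} (ha : a ∈ S) (hb : b ∈ S) : u a - v a = u b - v b := by
  have hd : DiscreteTopology (AddSubgroup.zmultiples (2 * Real.pi)) := inferInstance
  refine hS.constant_of_mapsTo (T := (AddSubgroup.zmultiples (2 * Real.pi) : Set ℝ))
    (isDiscrete_iff_discreteTopology.2 hd) (f := fun s => u s - v s) (hu.sub hv).continuousOn ?_ ha hb
  intro s hsS
  obtain ⟨k, hk⟩ := Real.Angle.angle_eq_iff_two_pi_dvd_sub.1
    (Real.Angle.cos_sin_inj (hc s hsS) (hs s hsS))
  refine ⟨k, ?_⟩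
  simp only [zsmul_eq_mul]
  rw [hk]; ring

lemma differentiableAt_rad {x : E3} (hx : x ∉ Zaxis) : DifferentiableAt ℝ rad x := by
  have h := rad_pos hx
  have h' : (x 0) ^ 2 + (x 1) ^ 2 ≠ 0 := by
    intro h0; rw [rad, h0] at h; simp at h
  unfold rad
  refine DifferentiableAt.sqrt (f := fun x : E3 => (x 0) ^ 2 + (x 1) ^ 2) ?_ h'
  fun_prop

lemma continuous_rad : Continuous rad := by
  unfold rad; fun_prop

/-- forward direction: transversality -/
lemma forward_transverse {V : Set (ℝ × ℝ)} (hV : IsOpen V) (hpos : ∀ q ∈ V, 0 < q.1)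
    {θ : ℝ × ℝ → ℝ} (hθ : ContDiffOn ℝ (⊤ : ℕ∞) θ V) {q : ℝ × ℝ} (hq : q ∈ V) :
    pt (-(GG (q, θ q)) 1) ((GG (q, θ q)) 0) 0 ∉
      tangentConeAt ℝ ((fun q => GG (q, θ q)) '' V) (GG (q, θ q)) := by
  intro hmem
  set x := GG (q, θ q) with hxdef
  set M := (fun q => GG (q, θ q)) '' V with hM
  have hr : rad x = q.1 := rad_GG (hpos q hq) _
  have hxZ : x ∉ Zaxis := by
    rintro ⟨h0, h1⟩
    have := hpos q hq
    rw [← hr, rad, h0, h1] at this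
    simp at this
  let Φ : E3 → ℝ × ℝ := fun y => (rad y, y 2)
  have hΦx : Φ x = q := by
    apply Prod.ext
    · exact hr
    · simp [Φ, hxdef]
  have hΦ : DifferentiableAt ℝ Φ x := by
    apply (differentiableAt_rad hxZ).prodMk
    fun_prop
  have hθ' : DifferentiableAt ℝ θ q := (hθ.contDiffAt (hV.mem_nhds hq)).differentiableAt (by simp)
  have hG : DifferentiableAt ℝ (fun q => GG (q, θ q)) (Φ x) := by
    rw [hΦx]
    exact (contDiff_GG.differentiable (by simp)).differentiableAt.comp q
      (differentiableAt_id.prodMk hθ')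
  have h1 := (hG.hasFDerivAt.comp x hΦ.hasFDerivAt).hasFDerivWithinAt (s := M)
  have h2 : HasFDerivWithinAt (fun y => y) _ M x := h1.congr (by
    rintro _ ⟨q', hq', rfl⟩
    simp [Φ, rad_GG (hpos q' hq')]) (by
    simp only [Function.comp, hΦx]; rfl)
  have h3 := (hasFDerivWithinAt_id x M).unique_on h2 hmem
  have h4 : fderiv ℝ Φ x (pt (-x 1) (x 0) 0) = 0 := by
    have hrot0 : rot 0 x = x := by apply E3_ext <;> simp
    have h5 : HasFDerivAt Φ (fderiv ℝ Φ x) (rot 0 x) := by rw [hrot0]; exact hΦ.hasFDerivAt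
    have h6 := h5.comp_hasDerivAt (0 : ℝ) (hasDerivAt_rot x)
    have h7 : Φ ∘ (fun φ => rot φ x) = fun _ => Φ x := by
      funext φ; simp [Φ, rad_rot]
    rw [h7] at h6
    exact h6.unique (hasDerivAt_const _ _)
  simp only [ContinuousLinearMap.coe_id', id, ContinuousLinearMap.comp_apply, h4, map_zero] at h3
  apply hxZ
  have e0 := congrArg (fun y : E3 => y 0) h3
  have e1 := congrArg (fun y : E3 => y 1) h3
  simp at e0 e1
  exact ⟨by simpa using e1, by simpa using e0⟩

/-- kernel of the differential lies in the tangent cone -/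
lemma ker_tangent {f : E3 → ℝ} {V M : Set E3} {p : E3} (hV : IsOpen V) (hp : p ∈ V) (hpM : p ∈ M)
    (hf : ContDiffOn ℝ (⊤ : ℕ∞) f V) (hMV : M ∩ V = {x ∈ V | f x = 0})
    (hdf : fderiv ℝ f p ≠ 0) {v : E3} (hv : fderiv ℝ f p v = 0) : v ∈ tangentConeAt ℝ M p := by
  have hs : HasStrictFDerivAt f (fderiv ℝ f p) p :=
    (hf.contDiffAt (hV.mem_nhds hp)).hasStrictFDerivAt (by simp)
  have hfp : f p = 0 := by
    have : p ∈ M ∩ V := ⟨hpM, hp⟩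
    rw [hMV] at this; exact this.2
  have hsurj : (fderiv ℝ f p).range = ⊤ := by
    apply LinearMap.range_eq_top.2
    exact LinearMap.surjective (f := (fderiv ℝ f p).toLinearMap) (by
      intro h; apply hdf; ext x; exact congrArg (fun l : E3 →ₗ[ℝ] ℝ => l x) h)
  let g := hs.implicitFunction f _ hsurj (f p)
  have hg : HasStrictFDerivAt g (fderiv ℝ f p).ker.subtypeL 0 := hs.to_implicitFunction hsurj
  have hg0 : g 0 = p := hs.implicitFunction_apply_image hsurj
  have he : ∀ᶠ y in 𝓝 (0 : (fderiv ℝ f p).ker), f (g y) = f p := by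
    have := hs.map_implicitFunction_eq hsurj
    exact (Continuous.prodMk_right (f p)).tendsto (0 : (fderiv ℝ f p).ker) |>.eventually this
  have he2 : ∀ᶠ y in 𝓝 (0 : (fderiv ℝ f p).ker), g y ∈ V :=
    hg.continuousAt.eventually_mem (by rw [hg0]; exact hV.mem_nhds hp)
  have hN := he.and he2
  set S := {y | f (g y) = f p ∧ g y ∈ V} with hS
  have hSn : S ∈ 𝓝 (0 : (fderiv ℝ f p).ker) := hN
  have := (hg.hasFDerivAt.hasFDerivWithinAt (s := S)).mapsTo_tangent_cone
    (show (⟨v, LinearMap.mem_ker.2 hv⟩ : (fderiv ℝ f p).ker) ∈ _ by rw [tangentConeAt_of_mem_nhds hSn]; trivial)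
  rw [hg0] at this
  refine tangentConeAt_mono ?_ this
  rintro _ ⟨y, ⟨hy1, hy2⟩, rfl⟩
  have : g y ∈ M ∩ V := by rw [hMV]; exact ⟨hy2, by rw [hy1, hfp]⟩
  exact this.1

/-- local smooth angle functions. -/
lemma local_angle {M U : Set E3} (hM : IsEmbeddedSurfaceIn M U)
    (htr : ∀ q ∈ M, pt (-q 1) (q 0) 0 ∉ tangentConeAt ℝ M q)
    {q : ℝ × ℝ} {t : ℝ} (hq : 0 < q.1) (hm : GG (q, t) ∈ M) :
    ∃ τ : ℝ × ℝ → ℝ, τ q = t ∧ ContDiffAt ℝ (⊤ : ℕ∞) τ q ∧ ∃ ε > 0,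
      ContinuousOn τ (Metric.ball q ε) ∧ ∀ q' ∈ Metric.ball q ε, 0 < q'.1 ∧ GG (q', τ q') ∈ M := by
  obtain ⟨f, V, hV, hpV, -, hf, hMV, hdf⟩ := hM.2 _ hm
  have hd := hdf _ ⟨hm, hpV⟩
  have hfp : f (GG (q, t)) = 0 := by
    have : GG (q, t) ∈ M ∩ V := ⟨hm, hpV⟩
    rw [hMV] at this; exact this.2
  have hne : fderiv ℝ f (GG (q, t)) (pt (-(GG (q, t)) 1) ((GG (q, t)) 0) 0) ≠ 0 := fun h0 =>
    htr _ hm (ker_tangent hV hpV hm hf hMV hd h0)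
  have hfc : ContDiffAt ℝ (⊤ : ℕ∞) f (GG (q, t)) := hf.contDiffAt (hV.mem_nhds hpV)
  have hgc : ContDiffAt ℝ (⊤ : ℕ∞) (f ∘ GG) (q, t) := hfc.comp (q, t) contDiff_GG.contDiffAt
  have htop : ((⊤ : ℕ∞) : WithTop ℕ∞) ≠ 0 := by simp
  have hder : fderiv ℝ (f ∘ GG) (q, t) (0, 1) ≠ 0 := by
    have h1 : HasDerivAt (fun s : ℝ => (q, s)) ((0 : ℝ × ℝ), (1 : ℝ)) t :=
      (hasDerivAt_const t q).prodMk (hasDerivAt_id t)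
    have h2 := (hgc.differentiableAt htop).hasFDerivAt.comp_hasDerivAt t h1
    have h3 := (hfc.differentiableAt htop).hasFDerivAt.comp_hasDerivAt t (hasDerivAt_GG q t)
    have h4 := h2.unique h3
    rw [h4]
    simpa using hne
  have hinv : (fderiv ℝ (f ∘ GG) (q, t) ∘L .inr ℝ (ℝ × ℝ) ℝ).IsInvertible := by
    refine ⟨ContinuousLinearEquiv.unitsEquivAut ℝ (Units.mk0 _ hder), ?_⟩
    ext
    simp
  let τ := hgc.implicitFunction htop hinv
  have hτq : τ q = t := hgc.implicitFunction_apply_self htop hinv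
  have hτc : ContDiffAt ℝ (⊤ : ℕ∞) τ q := hgc.contDiffAt_implicitFunction htop hinv
  have hev : ∀ᶠ x in 𝓝 q, f (GG (x, τ x)) = 0 := by
    have := hgc.eventually_apply_implicitFunction htop hinv
    simp only [Function.comp, hfp] at this
    exact this
  have hcts : ∀ᶠ x in 𝓝 q, ContinuousAt τ x := by
    have := (hτc.of_le (m := 1) (by exact_mod_cast le_top)).eventually (by simp)
    exact this.mono fun x hx => hx.continuousAt
  have hVev : ∀ᶠ x in 𝓝 q, GG (x, τ x) ∈ V := by
    have hc : ContinuousAt (fun x => GG (x, τ x)) q :=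
      contDiff_GG.continuous.continuousAt.comp (continuousAt_id.prodMk hτc.continuousAt)
    exact hc.eventually_mem (by rw [hτq]; exact hV.mem_nhds hpV)
  have hposev : ∀ᶠ x : ℝ × ℝ in 𝓝 q, 0 < x.1 := continuous_fst.continuousAt.eventually_const_lt hq
  obtain ⟨ε, hε, hball⟩ := Metric.eventually_nhds_iff_ball.1 (hev.and (hcts.and (hVev.and hposev)))
  refine ⟨τ, hτq, hτc, ε, hε, fun x hx => (hball x hx).2.1.continuousWithinAt, fun x hx => ?_⟩
  obtain ⟨h1, h2, h3, h4⟩ := hball x hx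
  refine ⟨h4, ?_⟩
  have : GG (x, τ x) ∈ M ∩ V := by rw [hMV]; exact ⟨h3, h1⟩
  exact this.1

/-- the region in the half plane over which `M` lies. -/
def VV (M : Set E3) : Set (ℝ × ℝ) := {q | 0 < q.1 ∧ ∃ t, GG (q, t) ∈ M}

/-- the lifted surface. -/
def MM (M : Set E3) : Set ((ℝ × ℝ) × ℝ) := {u | 0 < u.1.1 ∧ GG u ∈ M}

/-- uniqueness of intersections -/
def UniqM (M : Set E3) : Prop := ∀ (q : ℝ × ℝ) (t t' : ℝ), 0 < q.1 → GG (q, t) ∈ M →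
  GG (q, t') ∈ M → GG (q, t) = GG (q, t')

/-- local angles exist -/
def LocM (M : Set E3) : Prop := ∀ (q : ℝ × ℝ) (t : ℝ), 0 < q.1 → GG (q, t) ∈ M →
  ∃ τ : ℝ × ℝ → ℝ, τ q = t ∧ ContDiffAt ℝ (⊤ : ℕ∞) τ q ∧ ∃ ε > 0,
      ContinuousOn τ (Metric.ball q ε) ∧ ∀ q' ∈ Metric.ball q ε, 0 < q'.1 ∧ GG (q', τ q') ∈ M

/-- closed curves have winding number zero -/
def WindM (M : Set E3) : Prop :=
  ∀ c : ℝ → E3, Continuous c → Function.Periodic c 1 → range c ⊆ M →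
    ∃ Θ : ℝ → ℝ, Continuous Θ ∧ Function.Periodic Θ 1 ∧
      ∀ s : ℝ, c s = GG ((rad (c s), c s 2), Θ s)

lemma isOpen_VV {M : Set E3} (hl : LocM M) : IsOpen (VV M) := by
  rw [Metric.isOpen_iff]
  rintro q ⟨hq, t, ht⟩
  obtain ⟨τ, -, -, ε, hε, -, h⟩ := hl q t hq ht
  exact ⟨ε, hε, fun q' hq' => ⟨(h q' hq').1, _, (h q' hq').2⟩⟩

lemma GG_inj {q : ℝ × ℝ} (hq : 0 < q.1) {t t' : ℝ} (h : GG (q, t) = GG (q, t')) :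
    Real.cos t = Real.cos t' ∧ Real.sin t = Real.sin t' := by
  have e0 := congrArg (fun y : E3 => y 0) h
  have e1 := congrArg (fun y : E3 => y 1) h
  simp only [GG_zero, GG_one] at e0 e1
  exact ⟨mul_left_cancel₀ hq.ne' e0, mul_left_cancel₀ hq.ne' e1⟩

lemma GG_shift {q : ℝ × ℝ} (hq : 0 < q.1) {t t' : ℝ} (h : GG (q, t) = GG (q, t'))
    (q' : ℝ × ℝ) (a : ℝ) : GG (q', a + (t - t')) = GG (q', a) := by
  obtain ⟨hc, hs⟩ := GG_inj hq h
  obtain ⟨k, hk⟩ := Real.Angle.angle_eq_iff_two_pi_dvd_sub.1 (Real.Angle.cos_sin_inj hc hs)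
  have : a + (t - t') = a + k * (2 * Real.pi) := by rw [hk]; ring
  rw [this]
  apply E3_ext <;> simp [Real.cos_add_int_mul_two_pi, Real.sin_add_int_mul_two_pi]

lemma exists_section {M : Set E3} (hu : UniqM M) (hl : LocM M) :
    ∃ σ : ℝ × ℝ → E3, ContinuousOn σ (VV M) ∧
      ∀ q ∈ VV M, σ q ∈ M ∧ ∀ t, GG (q, t) ∈ M → GG (q, t) = σ q := by
  have hex : ∀ q : ℝ × ℝ, ∃ x : E3, q ∈ VV M → (x ∈ M ∧ ∀ t, GG (q, t) ∈ M → GG (q, t) = x) := by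
    intro q
    by_cases hq : q ∈ VV M
    · obtain ⟨h0, t, ht⟩ := hq
      exact ⟨GG (q, t), fun _ => ⟨ht, fun t' ht' => hu q t' t h0 ht' ht⟩⟩
    · exact ⟨0, fun h => absurd h hq⟩
  choose σ hσ using hex
  refine ⟨σ, ?_, hσ⟩
  rintro q ⟨hq, t, ht⟩
  obtain ⟨τ, -, hc, ε, hε, -, h⟩ := hl q t hq ht
  have hcont : ContinuousAt (fun x => GG (x, τ x)) q :=
    contDiff_GG.continuous.continuousAt.comp (continuousAt_id.prodMk hc.continuousAt)
  apply ContinuousAt.continuousWithinAt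
  refine hcont.congr ?_
  filter_upwards [Metric.ball_mem_nhds q hε] with q' hq'
  exact (hσ q' ⟨(h q' hq').1, _, (h q' hq').2⟩).2 _ (h q' hq').2

lemma lift_path {M : Set E3} (hu : UniqM M) (hl : LocM M) (hw : WindM M)
    {q q' : ℝ × ℝ} {t : ℝ} (hj : JoinedIn (VV M) q q') (ht : GG (q, t) ∈ M) :
    ∃ t', JoinedIn (MM M) (q, t) (q', t') := by
  obtain ⟨σ, hσc, hσ⟩ := exists_section hu hl
  obtain ⟨γ, hγ⟩ := hj
  have heV : ∀ s, γ.extend s ∈ VV M := by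
    intro s
    have : γ.extend s ∈ range γ := by rw [← γ.extend_range]; exact mem_range_self s
    obtain ⟨s', hs'⟩ := this
    rw [← hs']; exact hγ s'
  have hσe : ∀ p ∈ VV M, rad (σ p) = p.1 ∧ σ p 2 = p.2 := by
    rintro p hp
    obtain ⟨h0, a, ha⟩ := hp
    have := (hσ p ⟨h0, a, ha⟩).2 a ha
    rw [← this]
    exact ⟨rad_GG h0 a, by simp⟩
  let k : ℝ → ℝ := fun s => (1 - Real.cos (s * (2 * Real.pi))) / 2
  have hk : Continuous k := by fun_prop
  let c : ℝ → E3 := fun s => σ (γ.extend (k s))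
  have hc : Continuous c :=
    hσc.comp_continuous (γ.continuous_extend.comp hk) (fun s => heV _)
  obtain ⟨Θ, hΘ, -, hΘc⟩ := hw c hc (by
    intro s
    have : k (s + 1) = k s := by
      simp only [k, add_mul, one_mul, Real.cos_add_two_pi]
    simp only [c, this]) (by
    rintro _ ⟨s, rfl⟩
    exact (hσ _ (heV _)).1)
  have hΘ2 : ∀ s, GG (γ.extend (k s), Θ s) ∈ M := by
    intro s
    have h1 := hΘc s
    obtain ⟨h2, h3⟩ := hσe _ (heV (k s))
    have h4 : ((rad (c s), c s 2) : ℝ × ℝ) = γ.extend (k s) := Prod.ext h2 h3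
    rw [h4] at h1
    rw [← h1]
    exact (hσ _ (heV _)).1
  have hk0 : k 0 = 0 := by simp [k]
  have hk1 : k (1 / 2) = 1 := by
    have : (1 / 2 : ℝ) * (2 * Real.pi) = Real.pi := by ring
    simp only [k, this, Real.cos_pi]; norm_num
  have hq0 : 0 < q.1 := by have := (heV 0).1; simpa using this
  have h0 : GG (q, t) = GG (q, Θ 0) := by
    apply hu q _ _ hq0 ht
    have := hΘ2 0
    rw [hk0, γ.extend_zero] at this
    exact this
  refine ⟨Θ (1 / 2) + (t - Θ 0), ?_⟩
  refine JoinedIn.ofLine (f := fun s => (γ.extend (k (s / 2)), Θ (s / 2) + (t - Θ 0))) ?_ ?_ ?_ ?_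
  · apply Continuous.continuousOn
    exact (γ.continuous_extend.comp (hk.comp (continuous_id.div_const 2))).prodMk
      ((hΘ.comp (continuous_id.div_const 2)).add continuous_const)
  · simp [hk0]
  · simp only [hk1, γ.extend_one]
  · rintro _ ⟨s, -, rfl⟩
    refine ⟨(heV _).1, ?_⟩
    rw [GG_shift hq0 h0]
    exact hΘ2 _

lemma unique_lift {M : Set E3} (hu : UniqM M) (hw : WindM M)
    {q : ℝ × ℝ} {t t' : ℝ} (hj : JoinedIn (MM M) (q, t) (q, t')) : t = t' := by
  have hm := hj.mem
  have htt := hu q t t' hm.1.1 hm.1.2 hm.2.2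
  obtain ⟨γ, hγ⟩ := hj
  have heV : ∀ s, γ.extend s ∈ MM M := by
    intro s
    have : γ.extend s ∈ range γ := by rw [← γ.extend_range]; exact mem_range_self s
    obtain ⟨s', hs'⟩ := this
    rw [← hs']; exact hγ s'
  have h01 : (GG ∘ γ.extend) 0 = (GG ∘ γ.extend) 1 := by simpa using htt
  have hcont : Continuous (GG ∘ γ.extend) := contDiff_GG.continuous.comp γ.continuous_extend
  obtain ⟨Θ, hΘ, hΘp, hΘc⟩ := hw ((GG ∘ γ.extend) ∘ Int.fract) (hcont.continuousOn.comp_fract'' h01)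
    (by intro s; simp) (by rintro _ ⟨s, rfl⟩; exact (heV _).2)
  have hev : ∀ s ∈ Icc (0 : ℝ) 1, ((GG ∘ γ.extend) ∘ Int.fract) s = GG (γ.extend s) := by
    rintro s ⟨hs0, hs1⟩
    rcases hs1.lt_or_eq with h | h
    · simp [Int.fract_eq_self.2 ⟨hs0, h⟩]
    · subst h
      simpa using htt
  have hcs : ∀ s ∈ Icc (0 : ℝ) 1, Real.cos (Θ s) = Real.cos (γ.extend s).2 ∧
      Real.sin (Θ s) = Real.sin (γ.extend s).2 := by
    intro s hs
    have h1 := hΘc s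
    rw [hev s hs, rad_GG (q := (γ.extend s).1) (heV s).1, GG_two] at h1
    exact GG_inj (heV s).1 h1.symm
  have := angle_const hΘ (continuous_snd.comp γ.continuous_extend) isPreconnected_Icc
    (fun s hs => (hcs s hs).1) (fun s hs => (hcs s hs).2)
    (left_mem_Icc.2 zero_le_one) (right_mem_Icc.2 zero_le_one)
  have hp := hΘp 0
  simp only [zero_add] at hp
  simp [hp] at this
  exact this

lemma exists_global {M : Set E3} (hu : UniqM M) (hl : LocM M) (hw : WindM M) :
    ∃ θ : ℝ × ℝ → ℝ, ContDiffOn ℝ (⊤ : ℕ∞) θ (VV M) ∧ ∀ q ∈ VV M, GG (q, θ q) ∈ M := by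
  classical
  let B : Set (ℝ × ℝ) → (ℝ × ℝ) × ℝ := fun C => Classical.epsilon (fun u => u ∈ MM M ∧ u.1 ∈ C)
  let θ : ℝ × ℝ → ℝ := fun q => Classical.epsilon
    (fun t => JoinedIn (MM M) (B (pathComponentIn (VV M) q)) (q, t))
  have hB : ∀ q ∈ VV M, B (pathComponentIn (VV M) q) ∈ MM M ∧
      (B (pathComponentIn (VV M) q)).1 ∈ pathComponentIn (VV M) q := by
    rintro q ⟨h0, t, ht⟩
    exact Classical.epsilon_spec (p := fun u => u ∈ MM M ∧ u.1 ∈ pathComponentIn (VV M) q)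
      ⟨(q, t), ⟨h0, ht⟩, JoinedIn.refl ⟨h0, t, ht⟩⟩
  have hθ : ∀ q ∈ VV M, JoinedIn (MM M) (B (pathComponentIn (VV M) q)) (q, θ q) := by
    intro q hq
    obtain ⟨h1, h2⟩ := hB q hq
    have h3 : JoinedIn (VV M) (B (pathComponentIn (VV M) q)).1 q := JoinedIn.symm h2
    exact Classical.epsilon_spec
      (p := fun t => JoinedIn (MM M) (B (pathComponentIn (VV M) q)) (q, t))
      (lift_path hu hl hw h3 h1.2)
  refine ⟨θ, ?_, fun q hq => (hθ q hq).target_mem.2⟩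
  intro q hq
  apply ContDiffAt.contDiffWithinAt
  obtain ⟨τ, hτq, hτ, ε, hε, hτc, hball⟩ := hl q (θ q) hq.1 (hθ q hq).target_mem.2
  refine hτ.congr_of_eventuallyEq ?_
  filter_upwards [Metric.ball_mem_nhds q hε] with q' hq'
  have hjb : JoinedIn (Metric.ball q ε) q q' :=
    ((convex_ball q ε).isPathConnected ⟨q, Metric.mem_ball_self hε⟩).joinedIn _
      (Metric.mem_ball_self hε) _ hq'
  have hjM : JoinedIn (MM M) (q, τ q) (q', τ q') := by
    refine (hjb.map_continuousOn (f := fun x => (x, τ x)) (continuousOn_id.prodMk hτc)).mono ?_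
    rintro _ ⟨x, hx, rfl⟩
    exact hball x hx
  have hjV : JoinedIn (VV M) q q' :=
    hjb.mono fun x hx => ⟨(hball x hx).1, _, (hball x hx).2⟩
  have hcomp : pathComponentIn (VV M) q' = pathComponentIn (VV M) q := pathComponentIn_congr hjV
  have h1 := hθ q' hjV.target_mem
  rw [hcomp] at h1
  rw [hτq] at hjM
  exact unique_lift hu hw (h1.symm.trans ((hθ q hq).trans hjM))

/-- Characterization of θ-graphs: a smooth embedded surface `M` in `W \ Z`
(`W` a rotationally invariant domain) is a θ-graph if and only if
(a) `M` meets each rotationally invariant circle at most once, and transversally, and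
(b) every closed curve in `M` has winding number `0` about `Z` (equivalently, the
angular coordinate admits a continuous periodic lift along any closed curve). -/
theorem thetaGraph_characterization (W : Set E3) (hW : IsOpen W)
    (hWrot : ∀ φ, rot φ '' W = W)
    (M : Set E3) (hM : IsEmbeddedSurfaceIn M (W \ Zaxis)) :
    IsThetaGraph W M ↔
      ((∀ p ∈ W \ Zaxis, (M ∩ circleThrough p).Subsingleton ∧
          ∀ q ∈ M ∩ circleThrough p,
            deriv (fun φ => rot φ q) 0 ∉ tangentConeAt ℝ M q) ∧
        (∀ c : ℝ → E3, Continuous c → Function.Periodic c 1 → range c ⊆ M →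
          ∃ Θ : ℝ → ℝ, Continuous Θ ∧ Function.Periodic Θ 1 ∧
            ∀ s : ℝ,
              c s 0 = Real.sqrt ((c s 0) ^ 2 + (c s 1) ^ 2) * Real.cos (Θ s) ∧
              c s 1 = Real.sqrt ((c s 0) ^ 2 + (c s 1) ^ 2) * Real.sin (Θ s))) := by
  have hsq : ∀ x : E3, Real.sqrt ((x 0) ^ 2 + (x 1) ^ 2) = rad x := fun x => rfl
  simp only [hsq, fun q => (hasDerivAt_rot q).deriv]
  constructor
  · rintro ⟨V, hV, hVW, θ, hθ, rfl⟩
    have hpos : ∀ q ∈ V, 0 < q.1 := fun q hq => (hVW hq).1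
    refine ⟨?_, ?_⟩
    · rintro p -
      refine ⟨?_, ?_⟩
      · rintro _ ⟨⟨q, hq, rfl⟩, φ, hφ⟩ _ ⟨⟨q', hq', rfl⟩, φ', hφ'⟩
        change rot φ p = GG (q, θ q) at hφ
        change rot φ' p = GG (q', θ q') at hφ'
        have : q = q' := by
          apply Prod.ext
          · rw [← rad_GG (hpos q hq) (θ q), ← rad_GG (hpos q' hq') (θ q'), ← hφ, ← hφ',
              rad_rot, rad_rot]
          · have h1 := congrArg (fun y : E3 => y 2) hφ
            have h2 := congrArg (fun y : E3 => y 2) hφ'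
            simp only [rot_two', GG_two] at h1 h2
            rw [← h1, ← h2]
        rw [this]
      · rintro _ ⟨⟨q, hq, rfl⟩, -⟩
        exact forward_transverse hV hpos hθ hq
    · intro c hc hper hran
      have hmem : ∀ s, (rad (c s), c s 2) ∈ V ∧
          c s = GG ((rad (c s), c s 2), θ (rad (c s), c s 2)) := by
        intro s
        obtain ⟨q, hq, hqc⟩ := hran (mem_range_self s)
        change GG (q, θ q) = c s at hqc
        have : ((rad (c s), c s 2) : ℝ × ℝ) = q := by
          apply Prod.ext
          · rw [← hqc]; exact rad_GG (hpos q hq) _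
          · rw [← hqc]; simp
        rw [this]
        exact ⟨hq, hqc.symm⟩
      refine ⟨fun s => θ (rad (c s), c s 2), ?_, ?_, ?_⟩
      · refine hθ.continuousOn.comp_continuous ?_ (fun s => (hmem s).1)
        exact (continuous_rad.comp hc).prodMk (by fun_prop)
      · intro s
        simp only [hper s]
      · intro s
        have h := (hmem s).2
        exact ⟨by simpa using congrArg (fun y : E3 => y 0) h,
          by simpa using congrArg (fun y : E3 => y 1) h⟩
  · rintro ⟨ha, hb⟩
    have hu : UniqM M := by
      intro q t t' hq h h'
      exact (ha _ (hM.1 h)).1 ⟨h, GG_mem_circle⟩ ⟨h', GG_mem_circle⟩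
    have htr : ∀ q ∈ M, pt (-q 1) (q 0) 0 ∉ tangentConeAt ℝ M q := by
      intro q hq
      exact (ha q (hM.1 hq)).2 q ⟨hq, 0, by apply E3_ext <;> simp⟩
    have hl : LocM M := fun q t hq h => local_angle hM htr hq h
    have hw : WindM M := by
      intro c hc hp hr
      obtain ⟨Θ, h1, h2, h3⟩ := hb c hc hp hr
      refine ⟨Θ, h1, h2, fun s => ?_⟩
      apply E3_ext
      · simpa using (h3 s).1
      · simpa using (h3 s).2
      · simp
    obtain ⟨θ, hθ, hθM⟩ := exists_global hu hl hw
    refine ⟨VV M, isOpen_VV hl, ?_, θ, hθ, ?_⟩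
    · rintro q ⟨hq, t, ht⟩
      refine ⟨hq, ?_⟩
      rw [← hWrot (-t)]
      refine ⟨GG (q, t), (hM.1 ht).1, ?_⟩
      rw [rot_GG]
      apply E3_ext <;> simp
    · apply Subset.antisymm
      · intro x hx
        obtain ⟨t, ht⟩ := exists_GG x
        have hr : 0 < rad x := rad_pos (hM.1 hx).2
        have hx' : GG ((rad x, x 2), t) ∈ M := ht ▸ hx
        have hV : ((rad x, x 2) : ℝ × ℝ) ∈ VV M := ⟨hr, t, hx'⟩
        refine ⟨(rad x, x 2), hV, ?_⟩
        exact (hu _ _ _ hr (hθM _ hV) hx').trans ht.symm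
      · rintro _ ⟨q, hq, rfl⟩
        exact hθM q hq
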